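/- (i) Let a, b ∈ (0,1) with a + b ≠ 1, let c ∈ ℝ, and let α ∈ (0,1). Then there exist ε ∈ (0,1) and N such that for all n > N, P_n(⌊an − c·n^α⌋, ⌊bn − c·n^α⌋) / C_n < ε^n. (ii) Let a ∈ (0,1), c ∈ ℝ with c ≠ 0, and α ∈ (1/2, 1). Then there exist ε ∈ (0,1) and N such that for all n > N, P_n(⌊an − c·n^α⌋, ⌊(1−a)n − c·n^α⌋) / C_n < ε^{n^{2α−1}}. -/

import Mathlib

open Filter Finset Real

/-- `σ` contains the pattern `τ`. -/
def ContainsPattern {n m : ℕ} (σ : Equiv.Perm (Fin n)) (τ : Equiv.Perm (Fin m)) : Prop :=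
  ∃ f : Fin m → Fin n, StrictMono f ∧ ∀ a b : Fin m, σ (f a) < σ (f b) ↔ τ a < τ b

/-- `σ` avoids the pattern `τ`. -/
def Avoids {n m : ℕ} (σ : Equiv.Perm (Fin n)) (τ : Equiv.Perm (Fin m)) : Prop :=
  ¬ ContainsPattern σ τ

/-- The pattern (1,2,3) ∈ S₃ (0-indexed: 0,1,2). -/
def pattern123 : Equiv.Perm (Fin 3) := 1

/-- The pattern (1,3,2) ∈ S₃ (0-indexed: 0,2,1). -/
def pattern132 : Equiv.Perm (Fin 3) := Equiv.swap 1 2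

/-- The pattern (3,2,1) ∈ S₃ (0-indexed: 2,1,0). -/
def pattern321 : Equiv.Perm (Fin 3) := Equiv.swap 0 2

/-- The pattern (2,3,1) ∈ S₃ (0-indexed: 1,2,0). -/
def pattern231 : Equiv.Perm (Fin 3) := (Equiv.swap 1 2).trans (Equiv.swap 0 1)

/-- `P_n(j,k)` with integer arguments: the number of 123-avoiding permutations of
`{1,…,n}` with value `k` in position `j` (1-indexed); `0` when `j` or `k` is out of
range. -/
noncomputable def PcountZ (n : ℕ) (j k : ℤ) : ℕ :=
  Nat.card {σ : Equiv.Perm (Fin n) //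
    Avoids σ pattern123 ∧ ∃ i : Fin n, ((i : ℕ) : ℤ) + 1 = j ∧ ((σ i : ℕ) : ℤ) + 1 = k}

/-- Concrete form of 123-avoidance. -/
def Av (n : ℕ) (σ : Equiv.Perm (Fin n)) : Prop :=
  ∀ p q r : Fin n, p < q → q < r → σ p < σ q → σ q < σ r → False

theorem av_of_avoids {n : ℕ} {σ : Equiv.Perm (Fin n)} (h : Avoids σ pattern123) : Av n σ := by
  intro p q r hpq hqr h1 h2
  apply h
  refine ⟨![p, q, r], ?_, ?_⟩
  · intro a b hab
    fin_cases a <;> fin_cases b <;> simp at hab ⊢ <;> first | assumption | exact hpq.trans hqr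
  · intro a b
    have h3 := h1.trans h2
    fin_cases a <;> fin_cases b <;>
      simp [pattern123, h1, h2, h3, h1.le, h2.le, h3.le]

open Classical in
/-- positions of left-to-right minima -/
noncomputable def lrm {n : ℕ} (σ : Equiv.Perm (Fin n)) : Finset (Fin n) :=
  univ.filter fun p => ∀ q < p, σ p < σ q

theorem mem_lrm {n : ℕ} (σ : Equiv.Perm (Fin n)) (p : Fin n) :
    p ∈ lrm σ ↔ ∀ q < p, σ p < σ q := by simp [lrm]

theorem eqOn_of_anti {n : ℕ} (S : Finset (Fin n)) (f g : Fin n → Fin n)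
    (hf : ∀ p ∈ S, ∀ q ∈ S, p < q → f q < f p) (hg : ∀ p ∈ S, ∀ q ∈ S, p < q → g q < g p)
    (h : S.image f = S.image g) : ∀ p ∈ S, f p = g p := by
  have hF : StrictMono (fun p : S => OrderDual.toDual (f p)) := by
    intro p q hpq
    exact hf p p.2 q q.2 hpq
  have hG : StrictMono (fun p : S => OrderDual.toDual (g p)) := by
    intro p q hpq
    exact hg p p.2 q q.2 hpq
  have := (StrictMono.range_inj hF hG).1 (by
    ext x
    have := Finset.ext_iff.1 h (OrderDual.ofDual x)
    simp only [Finset.mem_image] at this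
    simp only [Set.mem_range, Subtype.exists]
    constructor
    · rintro ⟨a, ha, rfl⟩
      obtain ⟨b, hb, hb'⟩ := this.1 ⟨a, ha, rfl⟩
      exact ⟨b, hb, hb'⟩
    · rintro ⟨a, ha, rfl⟩
      obtain ⟨b, hb, hb'⟩ := this.2 ⟨a, ha, rfl⟩
      exact ⟨b, hb, hb'⟩)
  intro p hp
  exact congrFun this ⟨p, hp⟩

theorem anti_lrm {n : ℕ} (σ : Equiv.Perm (Fin n)) :
    ∀ p ∈ lrm σ, ∀ q ∈ lrm σ, p < q → σ q < σ p :=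
  fun p _ q hq hpq => (mem_lrm σ q).1 hq p hpq

theorem anti_compl {n : ℕ} (σ : Equiv.Perm (Fin n)) (h : Av n σ) :
    ∀ p ∈ (lrm σ)ᶜ, ∀ q ∈ (lrm σ)ᶜ, p < q → σ q < σ p := by
  intro p hp q _ hpq
  rw [Finset.mem_compl, mem_lrm] at hp
  push Not at hp
  obtain ⟨r, hr, hr'⟩ := hp
  by_contra hc
  push Not at hc
  have h1 : σ p < σ q := lt_of_le_of_ne hc (fun e => hpq.ne (σ.injective e))
  have h2 : σ r < σ p := lt_of_le_of_ne hr' (fun e => hr.ne (σ.injective e))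
  exact h r p q hr hpq h2 h1

theorem code_inj {n : ℕ} (σ τ : Equiv.Perm (Fin n)) (hσ : Av n σ) (hτ : Av n τ)
    (h1 : lrm σ = lrm τ) (h2 : (lrm σ).image σ = (lrm τ).image τ) : σ = τ := by
  ext1 p
  by_cases hp : p ∈ lrm σ
  · refine eqOn_of_anti (lrm σ) σ τ (anti_lrm σ) (h1 ▸ anti_lrm τ) ?_ p hp
    rw [h2, h1]
  · refine eqOn_of_anti (lrm σ)ᶜ σ τ (anti_compl σ hσ) (h1 ▸ anti_compl τ hτ) ?_ p (by simpa using hp)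
    have key : ∀ (ρ : Equiv.Perm (Fin n)) (S : Finset (Fin n)), Sᶜ.image ρ = (S.image ρ)ᶜ := by
      intro ρ S
      rw [← Finset.coe_inj]
      push_cast
      exact Set.image_compl_eq ρ.bijective
    rw [key, key, h2, h1]

theorem card_match {n : ℕ} (σ : Equiv.Perm (Fin n)) (i : Fin n) (hi : i ∈ lrm σ) :
    ((lrm σ).filter (· < i)).card = (((lrm σ).image σ).filter (σ i < ·)).card := by
  rw [← Finset.card_image_of_injective _ σ.injective]
  congr 1
  ext w
  simp only [Finset.mem_image, Finset.mem_filter]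
  constructor
  · rintro ⟨p, ⟨hp, hpi⟩, rfl⟩
    exact ⟨⟨p, hp, rfl⟩, (mem_lrm σ i).1 hi p hpi⟩
  · rintro ⟨⟨p, hp, rfl⟩, hw⟩
    refine ⟨p, ⟨hp, ?_⟩, rfl⟩
    by_contra hc
    push Not at hc
    rcases hc.lt_or_eq with hc | rfl
    · exact absurd ((mem_lrm σ p).1 hp i hc) (not_lt.2 hw.le)
    · exact lt_irrefl _ hw

theorem sum_weights {n : ℕ} (P : Fin n → Prop) [DecidablePred P] (s : ℝ) :
    ∑ I : Finset (Fin n), s ^ (I.filter P).card =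
      (1 + s) ^ (univ.filter P).card * 2 ^ (n - (univ.filter P).card) := by
  have h : ∀ I : Finset (Fin n), s ^ (I.filter P).card = ∏ p ∈ I, if P p then s else 1 := by
    intro I
    rw [Finset.prod_ite]
    simp
  have h2 := Finset.prod_one_add (s := (univ : Finset (Fin n))) (f := fun p => if P p then s else 1)
  simp_rw [h]
  rw [Finset.powerset_univ] at h2
  rw [← h2]
  have h3 : ∀ p : Fin n, (1 + if P p then s else 1) = if P p then 1 + s else 2 := by
    intro p; split_ifs <;> norm_num
  simp_rw [h3]
  rw [Finset.prod_ite]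
  simp only [Finset.prod_const]
  congr 2
  have := Finset.card_filter_add_card_filter_not (s := (univ : Finset (Fin n))) P
  simp only [Finset.card_univ, Fintype.card_fin] at this
  omega

theorem one_add_exp_le (t : ℝ) : 1 + exp t ≤ 2 * exp (t / 2 + t ^ 2 / 8) := by
  have h1 := Real.cosh_le_exp_half_sq (t / 2)
  have h2 : 1 + exp t = 2 * (exp (t / 2) * cosh (t / 2)) := by
    rw [Real.cosh_eq]
    have : exp t = exp (t/2) * exp (t/2) := by rw [← exp_add]; ring_nf
    have h' : exp (t/2) * exp (-(t/2)) = 1 := by rw [← exp_add]; simp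
    rw [this]; linear_combination -h'
  rw [h2, exp_add]
  have h3 : t ^ 2 / 8 = (t / 2) ^ 2 / 2 := by ring
  rw [h3]
  have := exp_pos (t / 2)
  gcongr

/-- LR-min class -/
def LRset (n : ℕ) (i v : Fin n) : Set (Equiv.Perm (Fin n)) :=
  {σ | Av n σ ∧ σ i = v ∧ i ∈ lrm σ}

theorem lr_bound (n : ℕ) (i v : Fin n) (t : ℝ) :
    ((LRset n i v).ncard : ℝ) ≤
      4 ^ n * exp (t / 2 * ((i : ℝ) + v + 1 - n) + t ^ 2 * n / 4) := by
  classical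
  have hfin : (LRset n i v).Finite := Set.toFinite _
  set T := hfin.toFinset with hT
  have hmem : ∀ σ ∈ T, Av n σ ∧ σ i = v ∧ i ∈ lrm σ := by
    intro σ hσ; simpa [hT, LRset] using hσ
  rw [Set.ncard_eq_toFinset_card _ hfin]
  let F : Equiv.Perm (Fin n) → Finset (Fin n) × Finset (Fin n) :=
    fun σ => (lrm σ, (lrm σ).image σ)
  let W : Finset (Fin n) × Finset (Fin n) → ℝ := fun x =>
    exp t ^ (x.1.filter (· < i)).card * exp (-t) ^ (x.2.filter (v < ·)).card
  have hinj : Set.InjOn F T := by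
    intro σ hσ τ hτ h
    simp only [F, Prod.mk.injEq] at h
    exact code_inj σ τ (hmem σ hσ).1 (hmem τ hτ).1 h.1 h.2
  have hW : ∀ σ ∈ T, W (F σ) = 1 := by
    intro σ hσ
    obtain ⟨_, h2, h3⟩ := hmem σ hσ
    simp only [W, F]
    rw [card_match σ i h3, h2, ← mul_pow, ← exp_add]
    simp
  have h1 : (T.card : ℝ) ≤ ∑ x, W x := by
    calc (T.card : ℝ) = ∑ σ ∈ T, W (F σ) := by
          rw [Finset.sum_congr rfl hW]; simp
      _ = ∑ x ∈ T.image F, W x := (Finset.sum_image hinj).symm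
      _ ≤ ∑ x, W x := by
          apply Finset.sum_le_sum_of_subset_of_nonneg (Finset.subset_univ _)
          intros; positivity
  have h2 : ∑ x, W x = ((1 + exp t) ^ (i : ℕ) * 2 ^ (n - i)) *
      ((1 + exp (-t)) ^ (n - 1 - (v : ℕ)) * 2 ^ (n - (n - 1 - v))) := by
    have e1 := sum_weights (fun p : Fin n => p < i) (exp t)
    have e2 := sum_weights (fun p : Fin n => v < p) (exp (-t))
    have c1 : (univ.filter (fun p : Fin n => p < i)).card = i := by
      rw [Finset.filter_gt_eq_Iio, Fin.card_Iio]
    have c2 : (univ.filter (fun p : Fin n => v < p)).card = n - 1 - v := by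
      rw [Finset.filter_lt_eq_Ioi, Fin.card_Ioi]
    rw [c1] at e1
    rw [c2] at e2
    rw [← e1, ← e2, Fintype.sum_prod_type, Finset.sum_mul_sum]
  have hi := i.2
  have hv := v.2
  have p1 := one_add_exp_le t
  have p2 := one_add_exp_le (-t)
  have q1 : (1 + exp t) ^ (i : ℕ) ≤ (2 * exp (t / 2 + t ^ 2 / 8)) ^ (i : ℕ) :=
    pow_le_pow_left₀ (by positivity) p1 _
  have q2 : (1 + exp (-t)) ^ (n - 1 - (v : ℕ)) ≤
      (2 * exp (-t / 2 + (-t) ^ 2 / 8)) ^ (n - 1 - (v : ℕ)) :=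
    pow_le_pow_left₀ (by positivity) p2 _
  obtain ⟨a, ha⟩ : ∃ a, n = i + a := ⟨n - i, by omega⟩
  obtain ⟨b, hb⟩ : ∃ b, n = v + 1 + b := ⟨n - (v + 1), by omega⟩
  have s1 : n - (i : ℕ) = a := by omega
  have s2 : n - 1 - (v : ℕ) = b := by omega
  have s3 : n - b = v + 1 := by omega
  have hb' : (n : ℝ) = v + 1 + b := by exact_mod_cast hb
  have hin : (i : ℝ) ≤ n := by exact_mod_cast hi.le
  have hbn : (b : ℝ) ≤ n := by exact_mod_cast (by omega : b ≤ n)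
  refine h1.trans (h2.le.trans ?_)
  rw [s1, s2, s3] at *
  calc (1 + exp t) ^ (i : ℕ) * 2 ^ a * ((1 + exp (-t)) ^ b * 2 ^ ((v : ℕ) + 1))
      ≤ ((2 * exp (t / 2 + t ^ 2 / 8)) ^ (i : ℕ)) * 2 ^ a *
        ((2 * exp (-t / 2 + (-t) ^ 2 / 8)) ^ b * 2 ^ ((v : ℕ) + 1)) := by gcongr
    _ = (2 ^ ((i : ℕ) + a) * 2 ^ ((v : ℕ) + 1 + b)) *
        exp (i * (t / 2 + t ^ 2 / 8) + b * (-t / 2 + (-t) ^ 2 / 8)) := by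
        rw [exp_add (i * (t / 2 + t ^ 2 / 8)), exp_nat_mul, exp_nat_mul, mul_pow, mul_pow]; ring
    _ = 4 ^ n * exp (i * (t / 2 + t ^ 2 / 8) + b * (-t / 2 + (-t) ^ 2 / 8)) := by
        rw [← ha, ← hb, ← mul_pow]; norm_num
    _ ≤ _ := by
        refine mul_le_mul_of_nonneg_left (exp_le_exp.2 ?_) (by positivity)
        have ht : 0 ≤ t ^ 2 := sq_nonneg t
        have hv' : (v : ℝ) = n - 1 - b := by linarith
        rw [hv']
        have w1 := mul_le_mul_of_nonneg_left hin ht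
        have w2 := mul_le_mul_of_nonneg_left hbn ht
        nlinarith

theorem lr_bound' (n : ℕ) (i v : Fin n) :
    ((LRset n i v).ncard : ℝ) ≤
      4 ^ n * exp (-((i : ℝ) + v + 1 - n) ^ 2 / (4 * n)) := by
  have hn : (0 : ℝ) < n := by exact_mod_cast i.pos
  convert lr_bound n i v (-((i : ℝ) + v + 1 - n) / n) using 3
  field_simp
  ring

theorem rl_bound (n : ℕ) (i v : Fin n) :
    (({σ : Equiv.Perm (Fin n) | Av n σ ∧ σ i = v ∧ ∀ q, i < q → σ q < σ i} : Set _).ncard : ℝ) ≤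
      4 ^ n * exp (-((i : ℝ) + v + 1 - n) ^ 2 / (4 * n)) := by
  have h1 : ({σ : Equiv.Perm (Fin n) | Av n σ ∧ σ i = v ∧ ∀ q, i < q → σ q < σ i} : Set _).ncard
      ≤ (LRset n i.rev v.rev).ncard := by
    refine Set.ncard_le_ncard_of_injOn (fun σ => Fin.revPerm * σ * Fin.revPerm) ?_ ?_ (Set.toFinite _)
    · rintro σ ⟨h1, h2, h3⟩
      refine ⟨?_, ?_, ?_⟩
      · intro p q r hpq hqr a b
        simp only [Equiv.Perm.mul_apply, Fin.revPerm_apply, Fin.rev_lt_rev] at a b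
        exact h1 _ _ _ (Fin.rev_lt_rev.2 hqr) (Fin.rev_lt_rev.2 hpq) b a
      · simp [h2]
      · rw [mem_lrm]
        intro q hq
        simp only [Equiv.Perm.mul_apply, Fin.revPerm_apply, Fin.rev_lt_rev, Fin.rev_rev]
        exact h3 _ (by rw [← Fin.rev_lt_rev]; simpa using hq)
    · intro σ _ τ _ h
      simpa using h
  have h2 := lr_bound' n i.rev v.rev
  have h3 : (((LRset n i.rev v.rev).ncard : ℕ) : ℝ) ≤ 4 ^ n * exp (-((i : ℝ) + v + 1 - n) ^ 2 / (4 * n)) := by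
    convert h2 using 4
    have e1 : ((i.rev : ℕ) : ℝ) = n - 1 - i := by
      have : (i.rev : ℕ) + 1 + i = n := by rw [Fin.val_rev]; omega
      have : ((i.rev : ℕ) : ℝ) + 1 + i = n := by exact_mod_cast this
      linarith
    have e2 : ((v.rev : ℕ) : ℝ) = n - 1 - v := by
      have : (v.rev : ℕ) + 1 + v = n := by rw [Fin.val_rev]; omega
      have : ((v.rev : ℕ) : ℝ) + 1 + v = n := by exact_mod_cast this
      linarith
    rw [e1, e2]; ring
  exact le_trans (by exact_mod_cast h1) h3

theorem Pcount_bound (n : ℕ) (j k : ℤ) :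
    (PcountZ n j k : ℝ) ≤ 2 * 4 ^ n * exp (-((j : ℝ) + k - 1 - n) ^ 2 / (4 * n)) := by
  by_cases h : ∃ i v : Fin n, ((i : ℕ) : ℤ) + 1 = j ∧ ((v : ℕ) : ℤ) + 1 = k
  · obtain ⟨i, v, rfl, rfl⟩ := h
    have h1 : PcountZ n (((i : ℕ) : ℤ) + 1) (((v : ℕ) : ℤ) + 1) ≤
        (LRset n i v ∪ {σ : Equiv.Perm (Fin n) | Av n σ ∧ σ i = v ∧ ∀ q, i < q → σ q < σ i}).ncard := by
      unfold PcountZ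
      change Set.ncard {σ : Equiv.Perm (Fin n) | _} ≤ _
      apply Set.ncard_le_ncard _ (Set.toFinite _)
      rintro σ ⟨h1, i', h2, h3⟩
      have hi : i' = i := by ext; omega
      subst hi
      have hv : σ i' = v := by ext; omega
      have hav := av_of_avoids h1
      by_cases hl : i' ∈ lrm σ
      · exact Or.inl ⟨hav, hv, hl⟩
      · refine Or.inr ⟨hav, hv, ?_⟩
        intro q hq
        rw [mem_lrm] at hl
        push Not at hl
        obtain ⟨r, hr, hr'⟩ := hl
        by_contra hc
        push Not at hc
        exact hav r i' q hr hq (lt_of_le_of_ne hr' (fun e => hr.ne (σ.injective e)))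
          (lt_of_le_of_ne hc (fun e => hq.ne (σ.injective e)))
    have h2 := h1.trans (Set.ncard_union_le _ _)
    have h3 := lr_bound' n i v
    have h4 := rl_bound n i v
    have h5 : (PcountZ n (((i : ℕ) : ℤ) + 1) (((v : ℕ) : ℤ) + 1) : ℝ) ≤ (LRset n i v).ncard +
        ({σ : Equiv.Perm (Fin n) | Av n σ ∧ σ i = v ∧ ∀ q, i < q → σ q < σ i} : Set _).ncard := by
      exact_mod_cast h2
    push_cast at h5 ⊢
    have e : ((i : ℝ) + 1 + (v + 1) - 1 - n) = (i : ℝ) + v + 1 - n := by ring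
    rw [e]
    linarith
  · have : PcountZ n j k = 0 := by
      unfold PcountZ
      rw [Nat.card_eq_zero]
      left
      constructor
      rintro ⟨σ, _, i, h1, h2⟩
      exact h ⟨i, σ i, h1, h2⟩
    rw [this]
    simp only [Nat.cast_zero]
    positivity

theorem ratio_bound (n : ℕ) (hn : 0 < n) (j k : ℤ) :
    (PcountZ n j k : ℝ) / catalan n ≤
      4 * n * (n + 1) * exp (-((j : ℝ) + k - 1 - n) ^ 2 / (4 * n)) := by
  have h1 := Nat.four_pow_le_two_mul_self_mul_centralBinom n hn
  rw [← succ_mul_catalan_eq_centralBinom] at h1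
  have h2 : (4 : ℝ) ^ n ≤ 2 * n * ((n + 1) * catalan n) := by exact_mod_cast h1
  have hn' : (0 : ℝ) < n := by exact_mod_cast hn
  have hc : (0 : ℝ) < catalan n := by
    have : (0 : ℝ) < 4 ^ n := by positivity
    by_contra hc
    push Not at hc
    have : 2 * n * ((n + 1) * (catalan n : ℝ)) ≤ 0 := by
      have : ((n : ℝ) + 1) * (catalan n : ℝ) ≤ 0 := mul_nonpos_of_nonneg_of_nonpos (by positivity) hc
      exact mul_nonpos_of_nonneg_of_nonpos (by positivity) this
    linarith
  rw [div_le_iff₀ hc]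
  refine (Pcount_bound n j k).trans ?_
  have := exp_pos (-((j : ℝ) + k - 1 - n) ^ 2 / (4 * n))
  nlinarith

theorem main_decay (δ β : ℝ) (hδ : 0 < δ) (hβ : 1 / 2 < β) (j k : ℕ → ℤ)
    (h : ∀ᶠ n : ℕ in atTop, δ * (n : ℝ) ^ β ≤ |(j n : ℝ) + k n - 1 - n|) :
    ∀ᶠ n : ℕ in atTop, (PcountZ n (j n) (k n) : ℝ) / (catalan n : ℝ) <
      exp (-(δ ^ 2 / 8)) ^ ((n : ℝ) ^ (2 * β - 1)) := by
  have hg : 0 < 2 * β - 1 := by linarith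
  have ht : Tendsto (fun n : ℕ => (n : ℝ) ^ (2 * β - 1)) atTop atTop :=
    (tendsto_rpow_atTop hg).comp tendsto_natCast_atTop_atTop
  have hlog : ∀ᶠ n : ℕ in atTop, 4 * (n : ℝ) * (n + 1) < exp (δ ^ 2 / 8 * (n : ℝ) ^ (2 * β - 1)) := by
    have hd : 0 < δ ^ 2 / 8 := by positivity
    have h0 := (isLittleO_log_rpow_atTop hg).comp_tendsto tendsto_natCast_atTop_atTop
    have h1 := h0.bound (show (0:ℝ) < δ ^ 2 / 32 by positivity)
    have h2 := ht.eventually_gt_atTop (log 8 / (δ ^ 2 / 16))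
    filter_upwards [h1, h2, eventually_ge_atTop 1] with n h1 h2 hn
    have hn' : (1 : ℝ) ≤ n := by exact_mod_cast hn
    have hlogn : 0 ≤ log n := log_nonneg hn'
    simp only [Function.comp_apply, norm_eq_abs] at h1
    rw [abs_of_nonneg hlogn, abs_of_nonneg (by positivity)] at h1
    rw [div_lt_iff₀ (by positivity)] at h2
    have h8 : 4 * (n : ℝ) * (n + 1) ≤ exp (log 8 + 2 * log n) := by
      rw [exp_add, exp_log (by norm_num), two_mul, exp_add, exp_log (by linarith)]
      nlinarith
    refine h8.trans_lt (exp_lt_exp.2 ?_)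
    linarith
  filter_upwards [h, hlog, eventually_ge_atTop 1] with n h hlog hn
  have hn' : (0 : ℝ) < n := by exact_mod_cast hn
  refine (ratio_bound n hn (j n) (k n)).trans_lt ?_
  rw [← exp_mul]
  have hsq : (δ * (n : ℝ) ^ β) ^ 2 ≤ ((j n : ℝ) + k n - 1 - n) ^ 2 := by
    rw [← sq_abs ((j n : ℝ) + k n - 1 - n)]
    gcongr
  have hpow : ((n : ℝ) ^ β) ^ 2 = (n : ℝ) ^ (2 * β - 1) * n := by
    rw [← rpow_natCast, ← rpow_mul hn'.le]
    nth_rewrite 3 [← rpow_one (n : ℝ)]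
    rw [← rpow_add hn']
    congr 1
    push_cast; ring
  have hexp : exp (-((j n : ℝ) + k n - 1 - n) ^ 2 / (4 * n)) ≤
      exp (-(δ ^ 2 / 4 * (n : ℝ) ^ (2 * β - 1))) := by
    apply exp_le_exp.2
    rw [div_le_iff₀ (by positivity)]
    rw [mul_pow, hpow] at hsq
    linarith
  calc 4 * n * (n + 1) * exp (-((j n : ℝ) + k n - 1 - n) ^ 2 / (4 * n))
      ≤ 4 * n * (n + 1) * exp (-(δ ^ 2 / 4 * (n : ℝ) ^ (2 * β - 1))) := by gcongr
    _ < exp (δ ^ 2 / 8 * (n : ℝ) ^ (2 * β - 1)) * exp (-(δ ^ 2 / 4 * (n : ℝ) ^ (2 * β - 1))) := by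
        gcongr
    _ = _ := by rw [← exp_add]; congr 1; ring

theorem floor_dist (x y : ℝ) : |((⌊x⌋ : ℝ) + ⌊y⌋) - (x + y)| ≤ 2 := by
  have a1 := Int.floor_le x
  have a2 := Int.lt_floor_add_one x
  have b1 := Int.floor_le y
  have b2 := Int.lt_floor_add_one y
  rw [abs_le]; constructor <;> linarith

/-- Exponential decay of `P_n` away from the anti-diagonal: (i) for `a + b ≠ 1` the
ratio `P_n(⌊an - cn^α⌋, ⌊bn - cn^α⌋)/C_n` is eventually smaller than `ε^n` for some
`ε ∈ (0,1)`; (ii) for `a + b = 1`, `c ≠ 0` and `1/2 < α < 1` it is eventually smaller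
than `ε^{n^{2α-1}}`. -/
theorem Pcount_exponential_decay :
    (∀ a b : ℝ, 0 < a → a < 1 → 0 < b → b < 1 → a + b ≠ 1 →
      ∀ c : ℝ, ∀ α : ℝ, 0 < α → α < 1 →
        ∃ ε : ℝ, 0 < ε ∧ ε < 1 ∧ ∃ N : ℕ, ∀ n : ℕ, N < n →
          (PcountZ n ⌊a * n - c * (n : ℝ) ^ α⌋ ⌊b * n - c * (n : ℝ) ^ α⌋ : ℝ) /
              (catalan n : ℝ) < ε ^ n) ∧
    (∀ a : ℝ, 0 < a → a < 1 → ∀ c : ℝ, c ≠ 0 → ∀ α : ℝ, 1 / 2 < α → α < 1 →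
      ∃ ε : ℝ, 0 < ε ∧ ε < 1 ∧ ∃ N : ℕ, ∀ n : ℕ, N < n →
        (PcountZ n ⌊a * n - c * (n : ℝ) ^ α⌋ ⌊(1 - a) * n - c * (n : ℝ) ^ α⌋ : ℝ) /
            (catalan n : ℝ) < ε ^ ((n : ℝ) ^ (2 * α - 1))) := by
  constructor
  · intro a b _ _ _ _ hab c α hα0 hα1
    have hs : 0 < |a + b - 1| := abs_pos.2 (fun h => hab (by linarith))
    have hev := main_decay (|a + b - 1| / 2) 1 (by positivity) (by norm_num)
      (fun n => ⌊a * n - c * (n : ℝ) ^ α⌋) (fun n => ⌊b * n - c * (n : ℝ) ^ α⌋) (by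
        have hκ : (0:ℝ) < |a + b - 1| / (8 * (|c| + 1)) := by positivity
        have h1 := ((tendsto_rpow_atTop (sub_pos.2 hα1)).comp
          (tendsto_natCast_atTop_atTop (R := ℝ))).eventually_ge_atTop
            (1 / (|a + b - 1| / (8 * (|c| + 1))))
        have h2 := (tendsto_natCast_atTop_atTop (R := ℝ)).eventually_ge_atTop (12 / |a + b - 1|)
        filter_upwards [h1, h2, eventually_ge_atTop 1] with n h1 h2 hn
        simp only [Function.comp_apply] at h1
        have hp : 0 ≤ (n : ℝ) ^ α := by positivity
        have hn0 : (0 : ℝ) < n := by exact_mod_cast hn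
        rw [div_le_iff₀ hκ] at h1
        replace h1 : (n : ℝ) ^ α ≤ |a + b - 1| / (8 * (|c| + 1)) * n := by
          have hm : (n : ℝ) ^ α * (n : ℝ) ^ (1 - α) = n := by
            rw [← rpow_add hn0]; simp
          have h3 := mul_le_mul_of_nonneg_left h1 hp
          rw [← mul_assoc, hm] at h3
          linarith
        rw [div_le_iff₀ hs] at h2
        rw [rpow_one]
        have hf := floor_dist (a * n - c * (n : ℝ) ^ α) (b * n - c * (n : ℝ) ^ α)
        set X : ℝ := (⌊a * n - c * (n : ℝ) ^ α⌋ : ℝ)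
        set Y : ℝ := (⌊b * n - c * (n : ℝ) ^ α⌋ : ℝ)
        have hc : |2 * c * (n : ℝ) ^ α| ≤ |a + b - 1| * n / 4 := by
          rw [abs_mul, abs_mul, abs_of_nonneg hp, abs_two]
          have hc0 := abs_nonneg c
          calc 2 * |c| * (n : ℝ) ^ α ≤ 2 * (|c| + 1) * (|a + b - 1| / (8 * (|c| + 1)) * n) := by
                gcongr; linarith
            _ = _ := by field_simp; ring
        have e : (a + b - 1) * n = (X + Y - 1 - n) -
            ((X + Y) - (a * n - c * (n : ℝ) ^ α + (b * n - c * (n : ℝ) ^ α))) + 1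
            + 2 * c * (n : ℝ) ^ α := by ring
        have e2 : |a + b - 1| * n ≤ |X + Y - 1 - n| + 2 + 1 + |a + b - 1| * n / 4 := by
          rw [← abs_of_nonneg (Nat.cast_nonneg (α := ℝ) n), ← abs_mul, 
            abs_of_nonneg (Nat.cast_nonneg (α := ℝ) n), e]
          refine (abs_add_le _ _).trans (add_le_add ((abs_add_le _ _).trans
            (add_le_add ((abs_sub _ _).trans (add_le_add le_rfl hf)) (by simp))) ?_)
          rw [← e]
          refine hc.trans (le_of_eq ?_)
          rw [abs_mul, abs_of_nonneg (Nat.cast_nonneg (α := ℝ) n)]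
        linarith)
    obtain ⟨N, hN⟩ := eventually_atTop.1 hev
    refine ⟨exp (-((|a + b - 1| / 2) ^ 2 / 8)), exp_pos _, exp_lt_one_iff.2 (by
      have : 0 < (|a + b - 1| / 2) ^ 2 / 8 := by positivity
      linarith), N, fun n hn => ?_⟩
    have := hN n hn.le
    have e : (2 * 1 - 1 : ℝ) = 1 := by norm_num
    rwa [e, rpow_one, rpow_natCast] at this
  · intro a _ _ c hc0 α hα hα1
    have hs : 0 < |c| := abs_pos.2 hc0
    have hα0 : 0 < α := by linarith
    have hev := main_decay |c| α hs hα
      (fun n => ⌊a * n - c * (n : ℝ) ^ α⌋) (fun n => ⌊(1 - a) * n - c * (n : ℝ) ^ α⌋) (by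
        have h2 := ((tendsto_rpow_atTop hα0).comp
          (tendsto_natCast_atTop_atTop (R := ℝ))).eventually_ge_atTop (3 / |c|)
        filter_upwards [h2] with n h2
        simp only [Function.comp_apply] at h2
        have hp : 0 ≤ (n : ℝ) ^ α := by positivity
        rw [div_le_iff₀ hs] at h2
        have hf := floor_dist (a * n - c * (n : ℝ) ^ α) ((1 - a) * n - c * (n : ℝ) ^ α)
        set X : ℝ := (⌊a * n - c * (n : ℝ) ^ α⌋ : ℝ)
        set Y : ℝ := (⌊(1 - a) * n - c * (n : ℝ) ^ α⌋ : ℝ)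
        have e : - (2 * c * (n : ℝ) ^ α) = (X + Y - 1 - n) -
            ((X + Y) - (a * n - c * (n : ℝ) ^ α + ((1 - a) * n - c * (n : ℝ) ^ α))) + 1 := by ring
        have e1 : |2 * c * (n : ℝ) ^ α| = 2 * |c| * (n : ℝ) ^ α := by
          rw [abs_mul, abs_mul, abs_of_nonneg hp, abs_two]
        have e2 : 2 * |c| * (n : ℝ) ^ α ≤ |X + Y - 1 - n| + 2 + 1 := by
          rw [← e1, ← abs_neg, e]
          exact (abs_add_le _ _).trans
            (add_le_add ((abs_sub _ _).trans (add_le_add le_rfl hf)) (by simp))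
        linarith)
    obtain ⟨N, hN⟩ := eventually_atTop.1 hev
    refine ⟨exp (-(|c| ^ 2 / 8)), exp_pos _, exp_lt_one_iff.2 (by
      have : 0 < |c| ^ 2 / 8 := by positivity
      linarith), N, fun n hn => hN n hn.le⟩
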